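/- Uniform LSI for exponential tilts of the uniform measure on an interval: for each fixed M > 0 there exists a constant C = C(M) > 0 such that for all h ∈ ℝ, the probability measure μ_h on (-M, M) with density proportional to e^{hx} satisfies the log-Sobolev inequality Ent_{μ_h}(f²) ≤ 2C E_{μ_h}[(f')²], uniformly in h. -/

import Mathlib

open MeasureTheory Real

/-- Entropy functional `Ent_ρ(f) = E_ρ[f log f] - E_ρ[f] log E_ρ[f]`. -/
noncomputable def Ent {α : Type*} [MeasurableSpace α] (ρ : Measure α) (f : α → ℝ) : ℝ :=
  (∫ x, f x * Real.log (f x) ∂ρ) - (∫ x, f x ∂ρ) * Real.log (∫ x, f x ∂ρ)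

/-- A bounded, Lipschitz, continuously differentiable test function on `ℝ`. -/
def Nice1 (f : ℝ → ℝ) : Prop :=
  ContDiff ℝ 1 f ∧ (∃ L, LipschitzWith L f) ∧ ∃ B, ∀ x, |f x| ≤ B

/-- The exponential tilt `μ_h` of the uniform measure on `(-M, M)`, with density
proportional to `e^{hx}`. -/
noncomputable def tiltMeasure (M h : ℝ) : Measure ℝ :=
  (volume.restrict (Set.Ioo (-M) M)).withDensity
    (fun x => ENNReal.ofReal (Real.exp (h * x) / ∫ u in Set.Ioo (-M) M, Real.exp (h * u)))

lemma pt_bound (a F t s H : ℝ) (hs : 0 < s) (ht : t = a ^ 2 + s) (hH : 0 ≤ H)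
    (hF : F ^ 2 ≤ s * exp H) :
    (a + F) ^ 2 * log ((a + F) ^ 2) ≤
      (a + F) ^ 2 * log t + (a + F) ^ 2 - t + 18 * F ^ 2 + 2 * s + 4 * H * F ^ 2 := by
  have htpos : 0 < t := by rw [ht]; positivity
  have hst : s ≤ t := by rw [ht]; nlinarith [sq_nonneg a]
  have hat : a ^ 2 ≤ t := by rw [ht]; linarith
  have hHF : 0 ≤ H * F ^ 2 := by positivity
  by_cases hc : F ^ 2 ≤ t
  · have hkey : ((a + F) ^ 2 - t) ^ 2 ≤ t * (18 * F ^ 2 + 2 * s) := by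
      have h1 : (2 * a + F) ^ 2 ≤ 9 * t := by nlinarith [sq_nonneg (a - F)]
      have h2 : F ^ 2 * (2 * a + F) ^ 2 ≤ F ^ 2 * (9 * t) :=
        mul_le_mul_of_nonneg_left h1 (sq_nonneg F)
      have h3 : s * s ≤ s * t := mul_le_mul_of_nonneg_left hst hs.le
      have h4 : (a + F) ^ 2 - t = F * (2 * a + F) - s := by rw [ht]; ring
      rw [h4]
      nlinarith [sq_nonneg (F * (2 * a + F) + s)]
    rcases (sq_nonneg (a + F)).eq_or_lt with h0 | hg
    · rw [← h0] at hkey ⊢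
      have : t ≤ 18 * F ^ 2 + 2 * s := by
        by_contra hcon
        push Not at hcon
        nlinarith
      linarith
    · generalize (a + F) ^ 2 = g at *
      have hl : log g - log t ≤ g / t - 1 := by
        rw [← log_div hg.ne' htpos.ne']
        exact log_le_sub_one_of_pos (div_pos hg htpos)
      have h5 : g * (log g - log t) ≤ g * (g / t - 1) := mul_le_mul_of_nonneg_left hl hg.le
      have h6 : g * (g / t - 1) = (g - t) ^ 2 / t + g - t := by field_simp; ring
      have h7 : (g - t) ^ 2 / t ≤ 18 * F ^ 2 + 2 * s := by
        rw [div_le_iff₀ htpos]; linarith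
      linarith
  · push Not at hc
    have hg4 : (a + F) ^ 2 ≤ 4 * F ^ 2 := by nlinarith [sq_nonneg (a - F)]
    have hg0 := sq_nonneg (a + F)
    generalize (a + F) ^ 2 = g at *
    have h8 : g * log g ≤ g * log t + 4 * F ^ 2 * (2 + H) := by
      rcases hg0.eq_or_lt with h0 | hg
      · rw [← h0]
        have : 0 ≤ 4 * F ^ 2 * (2 + H) := by positivity
        linarith
      · have hl : log g ≤ log t + (2 + H) := by
          have : g ≤ t * exp (2 + H) := by
            have e1 : (4:ℝ) ≤ exp 2 := by
              have h1 := add_one_le_exp (1:ℝ)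
              have : exp 2 = exp 1 * exp 1 := by rw [← exp_add]; norm_num
              nlinarith
            rw [exp_add]
            have h2 : s * exp H ≤ t * exp H := mul_le_mul_of_nonneg_right hst (exp_pos _).le
            have h3 : 0 ≤ t * exp H := by positivity
            nlinarith
          calc log g ≤ log (t * exp (2 + H)) := log_le_log hg this
            _ = _ := by rw [log_mul htpos.ne' (exp_pos _).ne', log_exp]
        have h9 := mul_le_mul_of_nonneg_left hl hg.le
        have h10 : g * (2 + H) ≤ 4 * F ^ 2 * (2 + H) :=
          mul_le_mul_of_nonneg_right hg4 (by linarith)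
        linarith
    nlinarith

lemma cs_int (g : ℝ → ℝ) (hg : Continuous g) (a b : ℝ) (hab : a ≤ b) :
    (∫ x in a..b, g x) ^ 2 ≤ (b - a) * ∫ x in a..b, g x ^ 2 := by
  rcases hab.eq_or_lt with rfl | hlt
  · simp
  set I := ∫ x in a..b, g x with hI
  set c := I / (b - a) with hc
  have hpos : 0 < b - a := sub_pos.2 hlt
  have h0 : 0 ≤ ∫ x in a..b, (g x - c) ^ 2 :=
    intervalIntegral.integral_nonneg hab (fun x _ => sq_nonneg _)
  have h1 : ∫ x in a..b, (g x - c) ^ 2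
      = (∫ x in a..b, g x ^ 2) - 2 * c * I + (b - a) * c ^ 2 := by
    have : (fun x => (g x - c) ^ 2) = fun x => (g x ^ 2 - 2 * c * g x) + c ^ 2 := by
      ext x; ring
    rw [this, intervalIntegral.integral_add, intervalIntegral.integral_sub,
      intervalIntegral.integral_const_mul, intervalIntegral.integral_const, smul_eq_mul]
    all_goals exact Continuous.intervalIntegrable (by fun_prop) _ _
  rw [h1] at h0
  have h2 : I = c * (b - a) := by rw [hc]; field_simp
  have h3 := mul_nonneg hpos.le h0
  rw [h2] at h3 ⊢
  nlinarith

/-- Main estimate, for a decreasing weight `w x = e^{-k x} / Z`. -/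
lemma main_est (M k Z : ℝ) (hM : 0 < M) (hk : 0 ≤ k) (hZ : 0 < Z)
    (w : ℝ → ℝ) (hw : ∀ x, w x = exp (-k * x) / Z)
    (hw1 : ∫ x in (-M)..M, w x = 1)
    (f : ℝ → ℝ) (hf : ContDiff ℝ 1 f) :
    (∫ x in (-M)..M, w x * (f x ^ 2 * log (f x ^ 2)))
      - (∫ x in (-M)..M, w x * f x ^ 2) * log (∫ x in (-M)..M, w x * f x ^ 2)
      ≤ 2 * (56 * M ^ 2) * ∫ x in (-M)..M, w x * (deriv f x) ^ 2 := by
  have hMM : -M ≤ M := by linarith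
  have hwc : Continuous w := by
    have : w = fun x => exp (-k * x) / Z := funext hw
    rw [this]; fun_prop
  have hwpos : ∀ x, 0 < w x := fun x => by rw [hw]; positivity
  have hfc : Continuous f := hf.continuous
  have hdc : Continuous (deriv f) := hf.continuous_deriv le_rfl
  have hfd : ∀ x, HasDerivAt f (deriv f x) x := fun x =>
    (hf.differentiable (by norm_num) x).hasDerivAt
  have hanti : ∀ x y, x ≤ y → w y ≤ w x := by
    intro x y hxy
    rw [hw, hw]
    gcongr ?_ / Z
    apply exp_le_exp.2
    nlinarith
  set E := ∫ x in (-M)..M, w x * (deriv f x) ^ 2 with hE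
  have hE0 : 0 ≤ E := intervalIntegral.integral_nonneg hMM
    (fun x _ => mul_nonneg (hwpos x).le (sq_nonneg _))
  set a := f (-M) with ha
  set F : ℝ → ℝ := fun x => f x - a with hFdef
  have hFc : Continuous F := by fun_prop
  have hFd : ∀ x, HasDerivAt F (deriv f x) x := fun x => (hfd x).sub_const a
  -- pointwise bound
  have hp : ∀ x ∈ Set.Icc (-M) M, w x * F x ^ 2 ≤ 2 * M * E := by
    intro x hx
    have h1 : F x = ∫ y in (-M)..x, deriv f y := by
      rw [intervalIntegral.integral_eq_sub_of_hasDerivAt (fun y _ => hfd y)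
        (hdc.intervalIntegrable _ _)]
    have h2 := cs_int (deriv f) hdc (-M) x hx.1
    rw [← h1] at h2
    have h3 : w x * ∫ y in (-M)..x, deriv f y ^ 2 ≤ ∫ y in (-M)..x, w y * deriv f y ^ 2 := by
      rw [← intervalIntegral.integral_const_mul]
      apply intervalIntegral.integral_mono_on hx.1
      · exact Continuous.intervalIntegrable (by fun_prop) _ _
      · exact Continuous.intervalIntegrable (by fun_prop) _ _
      · intro y hy
        exact mul_le_mul_of_nonneg_right (hanti y x hy.2) (sq_nonneg _)
    have h4 : ∫ y in (-M)..x, w y * deriv f y ^ 2 ≤ E := by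
      have hadd := intervalIntegral.integral_add_adjacent_intervals
        (f := fun y => w y * deriv f y ^ 2) (μ := volume) (a := -M) (b := x) (c := M)
        (Continuous.intervalIntegrable (by fun_prop) _ _)
        (Continuous.intervalIntegrable (by fun_prop) _ _)
      have : 0 ≤ ∫ y in x..M, w y * deriv f y ^ 2 := intervalIntegral.integral_nonneg hx.2
        (fun x _ => mul_nonneg (hwpos x).le (sq_nonneg _))
      linarith
    calc w x * F x ^ 2 ≤ w x * ((x - -M) * ∫ y in (-M)..x, deriv f y ^ 2) :=
          mul_le_mul_of_nonneg_left h2 (hwpos x).le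
      _ = (x + M) * (w x * ∫ y in (-M)..x, deriv f y ^ 2) := by ring
      _ ≤ (x + M) * E := mul_le_mul_of_nonneg_left (h3.trans h4) (by linarith [hx.1])
      _ ≤ 2 * M * E := mul_le_mul_of_nonneg_right (by linarith [hx.2]) hE0
  set V := ∫ x in (-M)..M, w x * F x ^ 2 with hV
  have hV1 : V ≤ 4 * M ^ 2 * E := by
    have : V ≤ ∫ x in (-M)..M, 2 * M * E := by
      apply intervalIntegral.integral_mono_on hMM
      · exact Continuous.intervalIntegrable (by fun_prop) _ _
      · exact Continuous.intervalIntegrable (by fun_prop) _ _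
      · exact hp
    rw [intervalIntegral.integral_const, smul_eq_mul] at this
    nlinarith
  -- Hardy
  have hV2 : k * V ≤ 4 * M * E := by
    have hwd : ∀ x, HasDerivAt w (-k * w x) x := by
      intro x
      have h1 : HasDerivAt (fun x => exp (-k * x) / Z) (exp (-k * x) * (-k * 1) / Z) x :=
        (((hasDerivAt_id x).const_mul (-k)).exp).div_const Z
      rw [show w = fun x => exp (-k * x) / Z from funext hw]
      convert h1 using 1
      ring
    have hd : ∀ x, HasDerivAt (fun x => w x * F x ^ 2)
        (2 * (w x * (F x * deriv f x)) - k * (w x * F x ^ 2)) x := by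
      intro x
      have h := (hwd x).mul ((hFd x).pow 2)
      refine HasDerivAt.congr_deriv h ?_
      simp only [Pi.pow_apply]
      push_cast
      ring
    have h1 := intervalIntegral.integral_eq_sub_of_hasDerivAt (a := -M) (b := M)
      (fun x _ => hd x) (Continuous.intervalIntegrable (by fun_prop) _ _)
    rw [intervalIntegral.integral_sub (Continuous.intervalIntegrable (by fun_prop) _ _)
        (Continuous.intervalIntegrable (by fun_prop) _ _),
      intervalIntegral.integral_const_mul, intervalIntegral.integral_const_mul, ← hV] at h1
    have h2 : F (-M) = 0 := by simp [hFdef, ha]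
    have h3 : 0 ≤ w M * F M ^ 2 := mul_nonneg (hwpos M).le (sq_nonneg _)
    have h4 : 2 * ∫ x in (-M)..M, w x * (F x * deriv f x) ≤ 1 / (2 * M) * V + 2 * M * E := by
      rw [hV, hE, ← intervalIntegral.integral_const_mul, ← intervalIntegral.integral_const_mul,
        ← intervalIntegral.integral_const_mul, ← intervalIntegral.integral_add
        (Continuous.intervalIntegrable (by fun_prop) _ _)
        (Continuous.intervalIntegrable (by fun_prop) _ _)]
      apply intervalIntegral.integral_mono_on hMM
      · exact Continuous.intervalIntegrable (by fun_prop) _ _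
      · exact Continuous.intervalIntegrable (by fun_prop) _ _
      · intro x _
        have : 1 / (2 * M) * (w x * F x ^ 2) + 2 * M * (w x * deriv f x ^ 2)
            - 2 * (w x * (F x * deriv f x))
            = w x / (2 * M) * (F x - 2 * M * deriv f x) ^ 2 := by
          field_simp; ring
        have h5 : 0 ≤ w x / (2 * M) * (F x - 2 * M * deriv f x) ^ 2 :=
          mul_nonneg (div_nonneg (hwpos x).le (by linarith)) (sq_nonneg _)
        linarith
    have h5 : 1 / (2 * M) * V ≤ 2 * M * E := by
      rw [one_div, inv_mul_le_iff₀ (by linarith)]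
      nlinarith
    rw [h2] at h1
    nlinarith
  -- lower bound on w
  have hwl : ∀ x, 1 ≤ 2 * M * (w x * exp (k * (x + M))) := by
    intro x
    have h1 : ∫ x in (-M)..M, w x ≤ ∫ y in (-M)..M, w (-M) := by
      apply intervalIntegral.integral_mono_on hMM
      · exact Continuous.intervalIntegrable (by fun_prop) _ _
      · exact Continuous.intervalIntegrable (by fun_prop) _ _
      · intro y hy
        exact hanti _ _ hy.1
    rw [hw1, intervalIntegral.integral_const, smul_eq_mul] at h1
    have h2 : w x * exp (k * (x + M)) = w (-M) := by
      rw [hw, hw, div_mul_eq_mul_div, ← exp_add]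
      congr 2; ring
    rw [h2]; linarith
  set m := ∫ x in (-M)..M, w x * f x ^ 2 with hm
  have hm0 : 0 ≤ m := intervalIntegral.integral_nonneg hMM
    (fun x _ => mul_nonneg (hwpos x).le (sq_nonneg _))
  have hcl : Continuous (fun x => f x ^ 2 * log (f x ^ 2)) :=
    Real.continuous_mul_log.comp (hfc.pow 2)
  apply le_of_forall_pos_le_add
  intro ε hε
  set s := 4 * M ^ 2 * E + ε / 2 with hs
  have hspos : 0 < s := by positivity
  set t := a ^ 2 + s with ht
  have htpos : 0 < t := by positivity
  have hpt : ∀ x ∈ Set.Icc (-M) M, w x * (f x ^ 2 * log (f x ^ 2)) ≤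
      (log t + 1) * (w x * f x ^ 2) + (2 * s - t) * w x
        + (18 + 8 * k * M) * (w x * F x ^ 2) := by
    intro x hx
    have hxM : 0 ≤ x + M := by linarith [hx.1]
    have hFs : F x ^ 2 ≤ s * exp (k * (x + M)) := by
      have h1 := hp x hx
      have h2 := hwl x
      have h3 : F x ^ 2 ≤ 2 * M * (2 * M * E) * exp (k * (x + M)) := by
        calc F x ^ 2 = F x ^ 2 * 1 := by ring
          _ ≤ F x ^ 2 * (2 * M * (w x * exp (k * (x + M)))) :=
            mul_le_mul_of_nonneg_left h2 (sq_nonneg _)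
          _ = (w x * F x ^ 2) * (2 * M * exp (k * (x + M))) := by ring
          _ ≤ (2 * M * E) * (2 * M * exp (k * (x + M))) :=
            mul_le_mul_of_nonneg_right h1 (by positivity)
          _ = _ := by ring
      refine h3.trans (mul_le_mul_of_nonneg_right ?_ (exp_pos _).le)
      rw [hs]; nlinarith
    have h1 := pt_bound a (F x) t s (k * (x + M)) hspos ht (by positivity) hFs
    have h2 : a + F x = f x := by simp [hFdef]
    rw [h2] at h1
    have h3 : 4 * (k * (x + M)) * F x ^ 2 ≤ 8 * k * M * F x ^ 2 := by
      apply mul_le_mul_of_nonneg_right _ (sq_nonneg _)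
      nlinarith [hx.2]
    have h4 := mul_le_mul_of_nonneg_left (h1.trans (add_le_add_right h3 _)) (hwpos x).le
    refine h4.trans (le_of_eq ?_)
    ring
  have hint : ∫ x in (-M)..M, w x * (f x ^ 2 * log (f x ^ 2)) ≤
      (log t + 1) * m + (2 * s - t) * (∫ x in (-M)..M, w x) + (18 + 8 * k * M) * V := by
    rw [hm, hV, ← intervalIntegral.integral_const_mul,
      ← intervalIntegral.integral_const_mul, ← intervalIntegral.integral_const_mul,
      ← intervalIntegral.integral_add
        (Continuous.intervalIntegrable (by fun_prop) _ _)
        (Continuous.intervalIntegrable (by fun_prop) _ _),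
      ← intervalIntegral.integral_add
        (Continuous.intervalIntegrable (by fun_prop) _ _)
        (Continuous.intervalIntegrable (by fun_prop) _ _)]
    apply intervalIntegral.integral_mono_on hMM
    · exact Continuous.intervalIntegrable (hwc.mul hcl) _ _
    · exact Continuous.intervalIntegrable (by fun_prop) _ _
    · exact hpt
  rw [hw1] at hint
  have hlog : m * log t + m - t ≤ m * log m := by
    rcases hm0.eq_or_lt with h0 | h0
    · rw [← h0]; simp; exact htpos.le
    · have h1 : log t - log m ≤ t / m - 1 := by
        rw [← log_div htpos.ne' h0.ne']
        exact log_le_sub_one_of_pos (div_pos htpos h0)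
      have h2 := mul_le_mul_of_nonneg_left h1 h0.le
      have h3 : m * (t / m - 1) = t - m := by field_simp
      linarith
  have hkM : 8 * M * (k * V) ≤ 8 * M * (4 * M * E) :=
    mul_le_mul_of_nonneg_left hV2 (by linarith)
  nlinarith

lemma integral_tilt (M h : ℝ) (hM : 0 < M) (g : ℝ → ℝ) :
    ∫ x, g x ∂(tiltMeasure M h) =
      ∫ x in (-M)..M, exp (h * x) / (∫ u in (-M)..M, exp (h * u)) * g x := by
  have hMM : -M ≤ M := by linarith
  have hZ : ∫ u in Set.Ioo (-M) M, exp (h * u) = ∫ u in (-M)..M, exp (h * u) := by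
    rw [intervalIntegral.integral_of_le hMM, integral_Ioc_eq_integral_Ioo]
  have hZ0 : 0 ≤ ∫ u in (-M)..M, exp (h * u) :=
    intervalIntegral.integral_nonneg hMM (fun x _ => (exp_pos _).le)
  unfold tiltMeasure
  rw [hZ]
  generalize (∫ u in (-M)..M, exp (h * u)) = Z at hZ0
  rw [integral_withDensity_eq_integral_toReal_smul (by fun_prop) (by simp),
    intervalIntegral.integral_of_le hMM, integral_Ioc_eq_integral_Ioo]
  refine integral_congr_ae (ae_of_all _ fun x => ?_)
  beta_reduce
  rw [ENNReal.toReal_ofReal (div_nonneg (exp_pos _).le hZ0), smul_eq_mul]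

lemma tilt_norm (M h : ℝ) (hM : 0 < M) :
    0 < (∫ u in (-M)..M, exp (h * u)) ∧
    ∫ x in (-M)..M, exp (h * x) / (∫ u in (-M)..M, exp (h * u)) = 1 := by
  have h1 : 0 < ∫ u in (-M)..M, exp (h * u) :=
    intervalIntegral.intervalIntegral_pos_of_pos
      (Continuous.intervalIntegrable (by fun_prop) _ _) (fun x => exp_pos _) (by linarith)
  refine ⟨h1, ?_⟩
  rw [intervalIntegral.integral_div, div_self h1.ne']

theorem stmt11 (M : ℝ) (hM : 0 < M) :
    ∃ C > 0, ∀ h : ℝ, ∀ f : ℝ → ℝ, Nice1 f →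
      Ent (tiltMeasure M h) (fun x => f x ^ 2) ≤
        2 * C * ∫ x, (deriv f x) ^ 2 ∂(tiltMeasure M h) := by
  refine ⟨56 * M ^ 2, by positivity, ?_⟩
  intro h f hf
  unfold Ent
  obtain ⟨hZ, hw1⟩ := tilt_norm M h hM
  simp only [integral_tilt M h hM]
  set Z := ∫ u in (-M)..M, exp (h * u) with hZdef
  rcases le_total h 0 with hh | hh
  · exact main_est M (-h) Z hM (by linarith) hZ (fun x => exp (h * x) / Z)
      (fun x => by rw [neg_neg]) hw1 f hf.1
  · have hrefl : ∀ g : ℝ → ℝ, ∫ x in (-M)..M, g x = ∫ x in (-M)..M, g (-x) := by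
      intro g
      rw [intervalIntegral.integral_comp_neg, neg_neg]
    have key := main_est M h Z hM hh hZ (fun x => exp (h * (-x)) / Z)
      (fun x => by simp) (by rw [← hw1, hrefl (fun x => exp (h * x) / Z)])
      (fun x => f (-x)) (hf.1.comp contDiff_neg)
    simp only [deriv_comp_neg, neg_sq] at key
    rw [hrefl (fun x => exp (h * x) / Z * (f x ^ 2 * log (f x ^ 2))),
      hrefl (fun x => exp (h * x) / Z * f x ^ 2),
      hrefl (fun x => exp (h * x) / Z * deriv f x ^ 2)]
    exact key
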